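/- Let p ≥ 5 be a prime, let k be an integer with 4 ≤ k ≤ p+1, and let F ∈ ℤ_(p)[Q,R] be isobaric of weight k and not involving P. Then for every integer i with 0 ≤ i ≤ k−1, the polynomial D^{p²−ip}F lies in the ideal (A^{2p−k+1−i}, p) of ℤ_(p)[P,Q,R]; that is, there exist polynomials G, H ∈ ℤ_(p)[P,Q,R] with D^{p²−ip}F = A^{2p−k+1−i}·G + p·H. -/

import Mathlib

open MvPolynomial Finset

noncomputable section

/-- `x` lies in `ℤ_(p) ⊆ ℚ`: `p` does not divide the reduced denominator of `x`. -/
def pInt (p : ℕ) (x : ℚ) : Prop := ¬ p ∣ x.den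

/-- The polynomial ring `ℚ[P,Q,R]`, with `P = X 0`, `Q = X 1`, `R = X 2`. -/
abbrev Poly3 : Type := MvPolynomial (Fin 3) ℚ

/-- `f` has all of its coefficients in `ℤ_(p)`. -/
def polyPInt (p : ℕ) (f : Poly3) : Prop := ∀ m : Fin 3 →₀ ℕ, pInt p (coeff m f)

/-- `f` is isobaric of weight `w`, where `P, Q, R` have weights `2, 4, 6`. -/
def Isobaric (w : ℕ) (f : Poly3) : Prop :=
  ∀ m ∈ f.support, 2 * m 0 + 4 * m 1 + 6 * m 2 = w

/-- `f` does not involve the variable `P`. -/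
def NoP (f : Poly3) : Prop := ∀ m ∈ f.support, m 0 = 0

/-- The Ramanujan derivation `D` on `ℚ[P,Q,R]`, the unique derivation with
`DP = (P²-Q)/12`, `DQ = (PQ-R)/3`, `DR = (PR-Q²)/2`. -/
def Dop (f : Poly3) : Poly3 :=
  C (1/12 : ℚ) * (X 0 ^ 2 - X 1) * pderiv 0 f
    + C (1/3 : ℚ) * (X 0 * X 1 - X 2) * pderiv 1 f
    + C (1/2 : ℚ) * (X 0 * X 2 - X 1 ^ 2) * pderiv 2 f

/-- The sum of the `j`-th powers of the divisors of `n`, as a rational number. -/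
def sigmaQ (j n : ℕ) : ℚ := ∑ d ∈ n.divisors, (d : ℚ) ^ j

/-- The q-expansion of `E₂`. -/
def E2s : PowerSeries ℚ := PowerSeries.mk fun n => if n = 0 then 1 else -24 * sigmaQ 1 n

/-- The q-expansion of `E₄`. -/
def E4s : PowerSeries ℚ := PowerSeries.mk fun n => if n = 0 then 1 else 240 * sigmaQ 3 n

/-- The q-expansion of `E₆`. -/
def E6s : PowerSeries ℚ := PowerSeries.mk fun n => if n = 0 then 1 else -504 * sigmaQ 5 n

/-- The q-expansion of the normalized Eisenstein series `E_{p-1}`. -/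
def EAs (p : ℕ) : PowerSeries ℚ :=
  PowerSeries.mk fun n => if n = 0 then 1 else
    -(2 * ((p : ℚ) - 1) / bernoulli (p - 1)) * sigmaQ (p - 2) n

/-- The q-expansion of the normalized Eisenstein series `E_{p+1}`. -/
def EBs (p : ℕ) : PowerSeries ℚ :=
  PowerSeries.mk fun n => if n = 0 then 1 else
    -(2 * ((p : ℚ) + 1) / bernoulli (p + 1)) * sigmaQ p n

/-- `Φ : ℚ[P,Q,R] → ℚ[[q]]`, the algebra map sending `P, Q, R` to `E₂, E₄, E₆`. -/
def Phi : Poly3 →ₐ[ℚ] PowerSeries ℚ := aeval ![E2s, E4s, E6s]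

/-- The theta operator attached to the polynomials `A` and `B`:
`θf = ((BQ-AR)/3)·∂f/∂Q + ((BR-AQ²)/2)·∂f/∂R`. -/
def thetaOp (A B f : Poly3) : Poly3 :=
  C (1/3 : ℚ) * (B * X 1 - A * X 2) * pderiv 1 f
    + C (1/2 : ℚ) * (B * X 2 - A * X 1 ^ 2) * pderiv 2 f

/-- `f` lies in the `n`-th power of the ideal `(A^p, p)` of `ℤ_(p)[P,Q,R]`. -/
def InIdealPow (p : ℕ) (A : Poly3) (n : ℕ) (f : Poly3) : Prop :=
  ∃ G : ℕ → Poly3, (∀ i, polyPInt p (G i)) ∧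
    f = ∑ i ∈ Finset.range (n + 1), (p : Poly3) ^ (n - i) * A ^ (p * i) * G i

/-- The operator `q d/dq` on power series. -/
def thD (K : Type*) [CommRing K] : Derivation K (PowerSeries K) (PowerSeries K) :=
  (PowerSeries.X : PowerSeries K) • PowerSeries.derivative K

theorem coeff_thD {K : Type*} [CommRing K] (f : PowerSeries K) (n : ℕ) :
    PowerSeries.coeff n (thD K f) = n * PowerSeries.coeff n f := by
  have : thD K f = PowerSeries.X * PowerSeries.derivative K f := rfl
  rw [this]
  cases n with
  | zero => simp
  | succ n =>
    rw [PowerSeries.coeff_succ_X_mul, PowerSeries.coeff_derivative]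
    push_cast; ring

section analytic
open UpperHalfPlane hiding I
open Complex Derivative ModularForm EisensteinSeries
open scoped Manifold MatrixGroups Topology Real

/-- `f` is given by the `q`-series `c`. -/
def HQ (f : ℍ → ℂ) (c : PowerSeries ℂ) : Prop :=
  ∀ τ : ℍ, HasSum (fun m : ℕ => PowerSeries.coeff m c • Function.Periodic.qParam 1 τ ^ m) (f τ)

theorem _root_.HasSum.congrFunC {f g : ℕ → ℂ} {a : ℂ} (h : HasSum f a) (hfg : ∀ m, g m = f m) :
    HasSum g a := by
  rwa [funext hfg]

theorem HQ.add {f g : ℍ → ℂ} {c d : PowerSeries ℂ} (hf : HQ f c) (hg : HQ g d) :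
    HQ (f + g) (c + d) := by
  intro τ
  simpa [add_mul] using (hf τ).add (hg τ)

theorem HQ.smul {f : ℍ → ℂ} {c : PowerSeries ℂ} (a : ℂ) (hf : HQ f c) :
    HQ (a • f) (a • c) := by
  intro τ
  simpa [mul_assoc] using (hf τ).mul_left a

theorem HQ.mul {f g : ℍ → ℂ} {c d : PowerSeries ℂ} (hf : HQ f c) (hg : HQ g d) :
    HQ (f * g) (c * d) := by
  intro τ
  have h := summable_norm_sum_mul_antidiagonal_of_summable_norm (hf τ).summable.norm
    (hg τ).summable.norm
  have h2 := tsum_mul_tsum_eq_tsum_sum_antidiagonal_of_summable_norm (hf τ).summable.norm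
    (hg τ).summable.norm
  rw [(hf τ).tsum_eq, (hg τ).tsum_eq] at h2
  rw [Pi.mul_apply, h2]
  refine h.of_norm.hasSum.congrFunC fun m => ?_
  rw [PowerSeries.coeff_mul, Finset.sum_smul]
  refine Finset.sum_congr rfl fun x hx => ?_
  rw [← Finset.HasAntidiagonal.mem_antidiagonal.mp hx, pow_add]
  simp only [smul_eq_mul]; ring

theorem HQ.deriv {f : ℍ → ℂ} {c : PowerSeries ℂ} (hf : HQ f c) :
    HQ (D f) (thD ℂ c) := by
  intro τ
  set F : ℕ → ℂ → ℂ := fun m w => PowerSeries.coeff m c * cexp (2 * π * Complex.I * w) ^ m with hF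
  have hτ := τ.im_pos
  let tauHalf : ℍ := ⟨⟨0, τ.im / 2⟩, by simpa using hτ⟩
  have key := Complex.hasSum_deriv_of_summable_norm (F := F) (U := {w : ℂ | τ.im / 2 < w.im})
    (u := fun m => ‖PowerSeries.coeff m c • Function.Periodic.qParam 1 tauHalf ^ m‖)
    (z := (τ : ℂ)) (hf tauHalf).summable.norm ?_ ?_ ?_ ?_
  · have hev : (f ∘ ofComplex) =ᶠ[𝓝 (τ : ℂ)] fun w => ∑' m, F m w := by
      filter_upwards [isOpen_upperHalfPlaneSet.mem_nhds τ.im_pos] with w hw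
      have := (hf ⟨w, hw⟩).tsum_eq
      rw [Function.comp_apply, ofComplex_apply_of_im_pos hw, ← this]
      refine tsum_congr fun m => ?_
      simp [hF, Function.Periodic.qParam]
    unfold normalizedDerivOfComplex
    rw [hev.deriv_eq]
    refine (key.mul_left (2 * π * Complex.I)⁻¹).congrFunC fun m => ?_
    have hd : HasDerivAt (F m) (PowerSeries.coeff m c * (m * cexp (2 * π * Complex.I * τ) ^ (m-1) *
        (cexp (2 * π * Complex.I * τ) * (2 * π * Complex.I)))) (τ : ℂ) := by
      have h1 : HasDerivAt (fun w : ℂ => cexp (2 * π * Complex.I * w))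
          (cexp (2 * π * Complex.I * τ) * (2 * π * Complex.I)) (τ : ℂ) := by
        simpa using ((hasDerivAt_id (τ : ℂ)).const_mul (2 * π * Complex.I)).cexp
      exact (h1.pow m).const_mul _
    rw [hd.deriv, coeff_thD]
    have hpi : (π : ℂ) ≠ 0 := by exact_mod_cast Real.pi_ne_zero
    cases m with
    | zero => simp
    | succ n =>
      simp [Function.Periodic.qParam, pow_succ]
      field_simp
      rw [Complex.I_sq]; ring
  · intro m
    fun_prop
  · exact isOpen_lt continuous_const Complex.continuous_im
  · intro m w hw
    simp only [hF, norm_smul, norm_mul, norm_pow]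
    gcongr
    simp only [Function.Periodic.qParam, Complex.norm_exp]
    apply Real.exp_le_exp.mpr
    have : (tauHalf : ℂ) = ⟨0, τ.im / 2⟩ := rfl
    simp [this]
    have hw : τ.im / 2 < w.im := hw
    nlinarith [Real.pi_pos]
  · show τ.im / 2 < (τ : ℂ).im
    have : (τ : ℂ).im = τ.im := rfl
    linarith

theorem HQ.eq_zero {f : ℍ → ℂ} {c : PowerSeries ℂ} (hf : HQ f c) (hfd : MDiff f) (k : ℕ)
    (hk : k < 12) (hsl : ∀ γ : SL(2, ℤ), f ∣[(k : ℤ)] γ = f) (h0 : PowerSeries.coeff 0 c = 0) :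
    c = 0 := by
  have hb : IsBoundedAtImInfty f := isBoundedAtImInfty_of_hasSum_qExpansion one_pos hf
  let G : ModularForm 𝒮ℒ (k : ℤ) :=
    { toFun := f
      slash_action_eq' := fun _ ⟨γ, hγ⟩ ↦ hγ ▸ hsl γ
      holo' := hfd
      bdd_at_cusps' {c} hc := by
        rw [Subgroup.IsArithmetic.isCusp_iff_isCusp_SL2Z] at hc
        rw [OnePoint.isBoundedAt_iff_forall_SL2Z hc]
        intro γ _
        rw [hsl γ]
        exact hb }
  have hu : ∀ m, PowerSeries.coeff m c = (qExpansion 1 G).coeff m := fun m =>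
    ModularFormClass.qExpansion_coeff_unique (f := G) one_pos one_mem_strictPeriods_SL hf m
  have hG : G = 0 := by
    apply sturm_bound_levelOne_nat
    rw [Nat.div_eq_of_lt hk]
    rw [Nat.cast_zero, pos_iff_ne_zero, PowerSeries.order_ne_zero_iff_constCoeff_eq_zero]
    rw [← PowerSeries.coeff_zero_eq_constantCoeff, ← hu 0, h0]
  ext m
  rw [hu m, hG]
  simp [qExpansion_zero]

end analytic
section analytic2
open UpperHalfPlane hiding I
open Complex Derivative ModularForm EisensteinSeries
open scoped Manifold MatrixGroups Topology Real

/-- scalar extension of the rational series -/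
def toC : PowerSeries ℚ →+* PowerSeries ℂ := PowerSeries.map (algebraMap ℚ ℂ)

theorem toC_inj : Function.Injective toC := by
  intro f g h
  ext n
  have := congrArg (PowerSeries.coeff n) h
  simpa [toC] using this

theorem toC_smul (a : ℚ) (f : PowerSeries ℚ) : toC (a • f) = (a : ℂ) • toC f := by
  ext n
  simp [toC]

theorem toC_thD (f : PowerSeries ℚ) : toC (thD ℚ f) = thD ℂ (toC f) := by
  ext n
  simp [toC, coeff_thD]

theorem sigmaQ_cast (j n : ℕ) : ((sigmaQ j n : ℚ) : ℂ) = (ArithmeticFunction.sigma j n : ℂ) := by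
  simp [sigmaQ, ArithmeticFunction.sigma_apply]

theorem c0_2 : PowerSeries.constantCoeff (toC E2s) = 1 := by
  rw [← PowerSeries.coeff_zero_eq_constantCoeff]; simp only [toC, PowerSeries.coeff_map, E2s, PowerSeries.coeff_mk]; simp
theorem c0_4 : PowerSeries.constantCoeff (toC E4s) = 1 := by
  rw [← PowerSeries.coeff_zero_eq_constantCoeff]; simp only [toC, PowerSeries.coeff_map, E4s, PowerSeries.coeff_mk]; simp
theorem c0_6 : PowerSeries.constantCoeff (toC E6s) = 1 := by
  rw [← PowerSeries.coeff_zero_eq_constantCoeff]; simp only [toC, PowerSeries.coeff_map, E6s, PowerSeries.coeff_mk]; simp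

theorem HQ_E2 : HQ E2 (toC E2s) := by
  intro τ
  have h := hasSum_qExpansion_E2 (z := τ)
  refine (h.congrFunC fun m => ?_)
  simp only [toC, E2s, PowerSeries.coeff_map, PowerSeries.coeff_mk, Function.Periodic.qParam, ofReal_one, div_one]
  congr 1
  split_ifs <;> simp [sigmaQ_cast]

theorem HQ_E4 : HQ E₄ (toC E4s) := by
  intro τ
  have h := ModularForm.hasSum_qExpansion (f := E₄) one_pos one_mem_strictPeriods_SL τ
  refine (h.congrFunC fun m => ?_)
  congr 1
  rw [E₄, EisensteinSeries.E_qExpansion_coeff _ (by decide)]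
  have : bernoulli 4 = -1/30 := by decide +kernel
  simp only [toC, E4s, PowerSeries.coeff_map, PowerSeries.coeff_mk, this]
  split_ifs <;> simp [sigmaQ_cast]
  norm_num

theorem HQ_E6 : HQ E₆ (toC E6s) := by
  intro τ
  have h := ModularForm.hasSum_qExpansion (f := E₆) one_pos one_mem_strictPeriods_SL τ
  refine (h.congrFunC fun m => ?_)
  congr 1
  rw [E₆, EisensteinSeries.E_qExpansion_coeff _ (by decide)]
  have : bernoulli 6 = 1/42 := by decide +kernel
  simp only [toC, E6s, PowerSeries.coeff_map, PowerSeries.coeff_mk, this]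
  split_ifs <;> simp [sigmaQ_cast]
  norm_num

theorem slash_inv {k : ℤ} (f : ModularForm 𝒮ℒ k) (γ : SL(2, ℤ)) : (f : ℍ → ℂ) ∣[k] γ = f :=
  SlashInvariantForm.slash_action_eqn f _ ⟨γ, rfl⟩

theorem ram4C : thD ℂ (toC E4s) + (-(1/3 : ℂ)) • (toC E2s * toC E4s) + (1/3 : ℂ) • toC E6s = 0 := by
  have hf : HQ (D E₄ + (-(1/3 : ℂ)) • (E2 * E₄) + (1/3 : ℂ) • (E₆ : ℍ → ℂ)) _ :=
    (HQ_E4.deriv.add ((HQ_E2.mul HQ_E4).smul (-(1/3)))).add (HQ_E6.smul (1/3))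
  have he : (D E₄ + (-(1/3 : ℂ)) • (E2 * E₄) + (1/3 : ℂ) • (E₆ : ℍ → ℂ)) =
      serreDerivative ((4 : ℤ) : ℂ) E₄ + (1/3 : ℂ) • (E₆ : ℍ → ℂ) := by
    ext z; simp; ring
  refine hf.eq_zero ?_ 6 (by norm_num) ?_ ?_
  · rw [he]
    exact (serreDerivative_mdifferentiable _ E₄.holo').add ((E₆.holo').const_smul _)
  · intro γ
    rw [he]
    have h1 := serreDerivative_slash_invariant (k := 4) (F := E₄) E₄.holo' (slash_inv E₄ γ)
    have h2 := slash_inv E₆ γ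
    show (_ + _) ∣[(6 : ℤ)] γ = _
    rw [SlashAction.add_slash, ModularForm.SL_smul_slash, h2]
    exact congrArg (· + _) h1
  · simp only [map_add, PowerSeries.coeff_smul, coeff_thD, PowerSeries.coeff_zero_eq_constantCoeff, map_mul, c0_2, c0_4, c0_6]
    simp

theorem ram6C : thD ℂ (toC E6s) + (-(1/2 : ℂ)) • (toC E2s * toC E6s) + (1/2 : ℂ) • (toC E4s * toC E4s) = 0 := by
  have hf : HQ (D E₆ + (-(1/2 : ℂ)) • (E2 * E₆) + (1/2 : ℂ) • ((E₄ : ℍ → ℂ) * E₄)) _ :=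
    (HQ_E6.deriv.add ((HQ_E2.mul HQ_E6).smul (-(1/2)))).add ((HQ_E4.mul HQ_E4).smul (1/2))
  have he : (D E₆ + (-(1/2 : ℂ)) • (E2 * E₆) + (1/2 : ℂ) • ((E₄ : ℍ → ℂ) * E₄)) =
      serreDerivative ((6 : ℤ) : ℂ) E₆ + (1/2 : ℂ) • ((E₄ : ℍ → ℂ) * E₄) := by
    ext z; simp; ring
  refine hf.eq_zero ?_ 8 (by norm_num) ?_ ?_
  · rw [he]
    exact (serreDerivative_mdifferentiable _ E₆.holo').add ((E₄.holo'.mul E₄.holo').const_smul _)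
  · intro γ
    rw [he]
    have h1 := serreDerivative_slash_invariant (k := 6) (F := E₆) E₆.holo' (slash_inv E₆ γ)
    have h2 := ModularForm.mul_slash_SL2 4 4 γ E₄ E₄
    rw [slash_inv E₄ γ] at h2
    show (_ + _) ∣[(8 : ℤ)] γ = _
    rw [SlashAction.add_slash, ModularForm.SL_smul_slash]
    exact congrArg₂ (· + (1/2 : ℂ) • ·) h1 h2
  · simp only [map_add, PowerSeries.coeff_smul, coeff_thD, PowerSeries.coeff_zero_eq_constantCoeff, map_mul, c0_2, c0_4, c0_6]
    simp

theorem D2_comp (γ : SL(2, ℤ)) (w : ℂ) (hw : 0 < w.im) : (D2 γ ∘ ofComplex) w =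
    (2 * π * Complex.I * γ 1 0) / (γ 1 0 * w + γ 1 1) := by
  rw [Function.comp_apply, ofComplex_apply_of_im_pos hw]
  show (2 * π * Complex.I * γ 1 0) / denom γ ((⟨w, hw⟩ : ℍ) : ℂ) = _
  rw [ModularGroup.denom_apply]

theorem D2_den (γ : SL(2, ℤ)) (w : ℂ) (hw : 0 < w.im) : (γ 1 0 * w + γ 1 1 : ℂ) ≠ 0 := by
  have := denom_ne_zero γ ⟨w, hw⟩
  rwa [ModularGroup.denom_apply] at this

theorem D2_hasDeriv (γ : SL(2, ℤ)) (w : ℂ) (hw : 0 < w.im) :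
    HasDerivAt (D2 γ ∘ ofComplex)
      (-(2 * π * Complex.I) * (γ 1 0 / (γ 1 0 * w + γ 1 1)) ^ 2) w := by
  have h0 := D2_den γ w hw
  have h1 : HasDerivAt (fun w : ℂ => (γ 1 0 * w + γ 1 1 : ℂ)) (γ 1 0 : ℂ) w := by
    simpa using ((hasDerivAt_id w).const_mul (γ 1 0 : ℂ)).add_const (γ 1 1 : ℂ)
  have h2 := (hasDerivAt_const w (2 * π * Complex.I * γ 1 0 : ℂ)).div h1 h0
  have h3 := h2.congr_of_eventuallyEq (f₁ := D2 γ ∘ ofComplex) (by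
    filter_upwards [isOpen_upperHalfPlaneSet.mem_nhds hw] with w hw
    exact D2_comp γ w hw)
  have e : (-(2 * π * Complex.I) * (γ 1 0 / (γ 1 0 * w + γ 1 1)) ^ 2 : ℂ) =
      (0 * (γ 1 0 * w + γ 1 1) - 2 * π * Complex.I * γ 1 0 * γ 1 0) / (γ 1 0 * w + γ 1 1) ^ 2 := by
    rw [div_pow]; ring
  rw [e]
  exact h3

theorem D_D2 (γ : SL(2, ℤ)) (z : ℍ) : D (D2 γ) z = - (γ 1 0 / denom γ z) ^ 2 := by
  unfold normalizedDerivOfComplex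
  rw [(D2_hasDeriv γ z z.im_pos).deriv, ModularGroup.denom_apply]
  have hpi : (π : ℂ) ≠ 0 := by exact_mod_cast Real.pi_ne_zero
  have := Complex.I_ne_zero
  field_simp

theorem D2_mdiff (γ : SL(2, ℤ)) : MDiff (D2 γ) := by
  rw [UpperHalfPlane.mdifferentiable_iff]
  intro w hw
  exact (D2_hasDeriv γ w hw).differentiableAt.differentiableWithinAt

theorem ram2C : thD ℂ (toC E2s) + (-(1/12 : ℂ)) • (toC E2s * toC E2s) + (1/12 : ℂ) • (toC E4s) = 0 := by
  have hf : HQ (D E2 + (-(1/12 : ℂ)) • (E2 * E2) + (1/12 : ℂ) • (E₄ : ℍ → ℂ)) _ :=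
    (HQ_E2.deriv.add ((HQ_E2.mul HQ_E2).smul (-(1/12)))).add ((HQ_E4).smul (1/12))
  refine hf.eq_zero ?_ 4 (by norm_num) ?_ ?_
  · exact ((normalizedDerivOfComplex_mdifferentiable E2_mdifferentiable).add
      ((E2_mdifferentiable.mul E2_mdifferentiable).const_smul _)).add (E₄.holo'.const_smul _)
  · intro γ
    have h1 := normalizedDerivOfComplex_SL_slash (k := 2) (F := E2) E2_mdifferentiable (γ := γ)
    have hs := E2_slash_action γ
    have h2 := ModularForm.mul_slash_SL2 2 2 γ E2 E2
    have h4 := slash_inv E₄ γ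
    rw [hs] at h1 h2
    rw [normalizedDerivOfComplex_sub _ _ E2_mdifferentiable ((D2_mdiff γ).const_smul _),
      normalizedDerivOfComplex_smul _ _ (D2_mdiff γ)] at h1
    have hh1 : D E2 ∣[(4 : ℤ)] γ = _ := (sub_eq_iff_eq_add.mp h1.symm)
    have hh2 : (E2 * E2) ∣[(4 : ℤ)] γ = _ := h2
    show (_ + _ + _) ∣[(4 : ℤ)] γ = _
    rw [SlashAction.add_slash, SlashAction.add_slash, ModularForm.SL_smul_slash,
      ModularForm.SL_smul_slash, h4, hh1, hh2]
    congr 1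
    ext z
    simp only [Pi.add_apply, Pi.sub_apply, Pi.smul_apply, Pi.mul_apply, smul_eq_mul, D_D2,
      riemannZeta_two]
    simp only [D2]
    have hpi : (π : ℂ) ≠ 0 := by exact_mod_cast Real.pi_ne_zero
    have hI := Complex.I_ne_zero
    have hd := denom_ne_zero γ z
    push_cast
    field_simp
    have hI2 := Complex.I_sq
    linear_combination (24 * (γ 1 0 : ℂ) * π * denom γ z * E2 z - 72 * (γ 1 0 : ℂ) ^ 2 * Complex.I) * hI2
  · simp only [map_add, PowerSeries.coeff_smul, coeff_thD, PowerSeries.coeff_zero_eq_constantCoeff, map_mul, c0_2, c0_4, c0_6]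
    simp

theorem ram2 : thD ℚ E2s = (1/12 : ℚ) • (E2s * E2s - E4s) := by
  apply toC_inj
  have h := ram2C
  rw [toC_thD]
  have e : toC ((1/12 : ℚ) • (E2s * E2s - E4s)) = (1/12 : ℂ) • (toC E2s * toC E2s - toC E4s) := by
    rw [toC_smul, map_sub, map_mul]; simp
  rw [e, ← sub_eq_zero, ← h]
  module

theorem ram4 : thD ℚ E4s = (1/3 : ℚ) • (E2s * E4s - E6s) := by
  apply toC_inj
  have h := ram4C
  rw [toC_thD]
  have e : toC ((1/3 : ℚ) • (E2s * E4s - E6s)) = (1/3 : ℂ) • (toC E2s * toC E4s - toC E6s) := by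
    rw [toC_smul, map_sub, map_mul]; simp
  rw [e, ← sub_eq_zero, ← h]
  module

theorem ram6 : thD ℚ E6s = (1/2 : ℚ) • (E2s * E6s - E4s * E4s) := by
  apply toC_inj
  have h := ram6C
  rw [toC_thD]
  have e : toC ((1/2 : ℚ) • (E2s * E6s - E4s * E4s)) =
      (1/2 : ℂ) • (toC E2s * toC E6s - toC E4s * toC E4s) := by
    rw [toC_smul, map_sub, map_mul]; simp
  rw [e, ← sub_eq_zero, ← h]
  module

end analytic2
section modp

/-- weights -/
abbrev wv : Fin 3 → ℕ := ![2, 4, 6]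

variable {K : Type*} [Field K]

/-- The Ramanujan derivation over a field. -/
def Dm (K : Type*) [Field K] :
    Derivation K (MvPolynomial (Fin 3) K) (MvPolynomial (Fin 3) K) :=
  (C (12⁻¹ : K) * (X 0 ^ 2 - X 1) : MvPolynomial (Fin 3) K) • (pderiv 0 :
      Derivation K (MvPolynomial (Fin 3) K) (MvPolynomial (Fin 3) K))
    + (C (3⁻¹ : K) * (X 0 * X 1 - X 2) : MvPolynomial (Fin 3) K) • (pderiv 1 :
      Derivation K (MvPolynomial (Fin 3) K) (MvPolynomial (Fin 3) K))
    + (C (2⁻¹ : K) * (X 0 * X 2 - X 1 ^ 2) : MvPolynomial (Fin 3) K) • (pderiv 2 :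
      Derivation K (MvPolynomial (Fin 3) K) (MvPolynomial (Fin 3) K))

theorem Dm_apply (f : MvPolynomial (Fin 3) K) : Dm K f =
    C (12⁻¹ : K) * (X 0 ^ 2 - X 1) * pderiv 0 f
    + C (3⁻¹ : K) * (X 0 * X 1 - X 2) * pderiv 1 f
    + C (2⁻¹ : K) * (X 0 * X 2 - X 1 ^ 2) * pderiv 2 f := rfl

/-- weighted homogeneous -/
abbrev WH (f : MvPolynomial (Fin 3) K) (w : ℕ) : Prop := IsWeightedHomogeneous wv f w

theorem WH_mul_pderiv {f g : MvPolynomial (Fin 3) K} {w a : ℕ} (i : Fin 3) (hf : WH f w)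
    (hg : WH g (wv i + a)) : WH (g * pderiv i f) (w + a) := by
  by_cases h : wv i ≤ w
  · obtain ⟨n, rfl⟩ := Nat.exists_eq_add_of_le h
    have := hg.mul (hf.pderiv (n' := n) (add_comm _ _))
    rwa [show wv i + n + a = wv i + a + n by ring]
  · have : pderiv i f = 0 := by
      ext m
      rw [coeff_pderiv, coeff_zero]
      by_contra hne
      have h1 := hf (left_ne_zero_of_mul hne)
      rw [map_add, Finsupp.weight_single, one_smul] at h1
      omega
    rw [this, mul_zero]
    exact isWeightedHomogeneous_zero _ _ _

theorem WH_X (i : Fin 3) : WH (X i : MvPolynomial (Fin 3) K) (wv i) := isWeightedHomogeneous_X _ _ _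

theorem WH.Dm {f : MvPolynomial (Fin 3) K} {w : ℕ} (hf : WH f w) : WH (Dm K f) (w + 2) := by
  rw [Dm_apply]
  refine ((WH_mul_pderiv 0 hf ?_).add (WH_mul_pderiv 1 hf ?_)).add (WH_mul_pderiv 2 hf ?_)
  · refine IsWeightedHomogeneous.C_mul (IsWeightedHomogeneous.sub ?_ ?_) _
    · exact (WH_X 0).pow 2
    · exact WH_X 1
  · refine IsWeightedHomogeneous.C_mul (IsWeightedHomogeneous.sub ?_ ?_) _
    · exact (WH_X 0).mul (WH_X 1)
    · exact WH_X 2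
  · refine IsWeightedHomogeneous.C_mul (IsWeightedHomogeneous.sub ?_ ?_) _
    · exact (WH_X 0).mul (WH_X 2)
    · exact (WH_X 1).pow 2

theorem WH.iter {f : MvPolynomial (Fin 3) K} {w : ℕ} (hf : WH f w) (n : ℕ) :
    WH ((_root_.Dm K)^[n] f) (w + 2 * n) := by
  induction n with
  | zero => exact hf
  | succ n ih =>
    rw [Function.iterate_succ_apply']
    exact ih.Dm

theorem WH.euler {f : MvPolynomial (Fin 3) K} {w : ℕ} (hf : WH f w) :
    2 * (X 0 * pderiv 0 f) + 4 * (X 1 * pderiv 1 f) + 6 * (X 2 * pderiv 2 f) = (w : MvPolynomial (Fin 3) K) * f := by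
  have := hf.sum_weight_X_mul_pderiv
  simp [Fin.sum_univ_three] at this
  exact this

theorem pderiv_swap (i j : Fin 3) (f : MvPolynomial (Fin 3) K) :
    pderiv i (pderiv j f) = pderiv j (pderiv i f) := by
  have : ⁅(pderiv i : Derivation K (MvPolynomial (Fin 3) K) (MvPolynomial (Fin 3) K)), (pderiv j : Derivation K (MvPolynomial (Fin 3) K) (MvPolynomial (Fin 3) K))⁆ = 0 := by
    apply MvPolynomial.derivation_ext
    intro k
    rw [Derivation.commutator_apply, pderiv_X, pderiv_X]
    simp [Pi.single_apply]
    split_ifs <;> simp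
  have h := congrArg (fun d => d f) this
  simp only [Derivation.commutator_apply] at h
  simpa [sub_eq_zero] using h

theorem comm_pderiv (h12 : (12 : K) ≠ 0) {f : MvPolynomial (Fin 3) K} {w : ℕ} (hf : WH f w) :
    pderiv 0 (Dm K f) = Dm K (pderiv 0 f) + C ((w : K) * 12⁻¹) * f := by
  have h2 : (2 : K) ≠ 0 := fun h => h12 (by linear_combination 6 * h)
  have h3 : (3 : K) ≠ 0 := fun h => h12 (by linear_combination 4 * h)
  have e3 : (3⁻¹ : K) = 4 * 12⁻¹ := by field_simp; norm_num
  have e2 : (2⁻¹ : K) = 6 * 12⁻¹ := by field_simp; norm_num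
  have he := hf.euler
  rw [Dm_apply, Dm_apply, pderiv_swap 1 0, pderiv_swap 2 0]
  simp only [map_add, Derivation.leibniz, map_sub, pderiv_C, smul_eq_mul, pderiv_pow,
    pderiv_X_self, pderiv_X_of_ne (show (1 : Fin 3) ≠ 0 by decide),
    pderiv_X_of_ne (show (2 : Fin 3) ≠ 0 by decide), C_mul, map_natCast]
  rw [mul_comm (w : MvPolynomial (Fin 3) K), mul_assoc (C (12⁻¹ : K)) (w : MvPolynomial (Fin 3) K), ← he, e3, e2]
  simp only [C_mul, map_ofNat]
  push_cast
  ring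

theorem pderiv_iter (h12 : (12 : K) ≠ 0) {f : MvPolynomial (Fin 3) K} {w : ℕ} (hf : WH f w)
    (h0 : pderiv 0 f = 0) (n : ℕ) :
    pderiv 0 ((Dm K)^[n + 1] f) = C (((n + 1 : ℕ) : K) * ((w + n : ℕ) : K) * 12⁻¹) * (Dm K)^[n] f := by
  induction n with
  | zero =>
    simp only [zero_add, Function.iterate_one, Function.iterate_zero, id]
    rw [comm_pderiv h12 hf, h0]
    simp
  | succ n ih =>
    rw [Function.iterate_succ_apply', comm_pderiv h12 (hf.iter (n + 1)), ih]
    rw [← MvPolynomial.smul_eq_C_mul, Derivation.map_smul, ← Function.iterate_succ_apply' (Dm K),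
      ← MvPolynomial.smul_eq_C_mul, ← MvPolynomial.smul_eq_C_mul, ← add_smul]
    congr 1
    push_cast
    ring

/-- degree in `P` at most `n` -/
def Pd (n : ℕ) (f : MvPolynomial (Fin 3) K) : Prop := degreeOf 0 f ≤ n

theorem Pd.mono {n m : ℕ} {f : MvPolynomial (Fin 3) K} (hf : Pd n f) (h : n ≤ m) : Pd m f :=
  le_trans hf h

theorem Pd_iff {n : ℕ} {f : MvPolynomial (Fin 3) K} : Pd n f ↔ ∀ m, n < m 0 → coeff m f = 0 := by
  rw [Pd, degreeOf_le_iff]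
  refine forall_congr' fun m => ?_
  rw [mem_support_iff, ← not_lt]
  tauto

theorem Pd.add {n : ℕ} {f g : MvPolynomial (Fin 3) K} (hf : Pd n f) (hg : Pd n g) : Pd n (f + g) :=
  (degreeOf_add_le _ _ _).trans (max_le hf hg)

theorem Pd.neg {n : ℕ} {f : MvPolynomial (Fin 3) K} (hf : Pd n f) : Pd n (-f) := by
  rw [Pd_iff] at *
  intro m hm
  rw [coeff_neg, hf m hm, neg_zero]

theorem Pd.sub {n : ℕ} {f g : MvPolynomial (Fin 3) K} (hf : Pd n f) (hg : Pd n g) :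
    Pd n (f - g) := by
  rw [sub_eq_add_neg]
  exact hf.add hg.neg

theorem Pd.mul {n m : ℕ} {f g : MvPolynomial (Fin 3) K} (hf : Pd n f) (hg : Pd m g) :
    Pd (n + m) (f * g) :=
  (degreeOf_mul_le _ _ _).trans (add_le_add hf hg)

theorem Pd_C (a : K) : Pd 0 (C a : MvPolynomial (Fin 3) K) := (degreeOf_C _ _).le
theorem Pd_nat (a : ℕ) : Pd 0 (a : MvPolynomial (Fin 3) K) := by
  rw [← map_natCast (C : K →+* MvPolynomial (Fin 3) K)]; exact Pd_C _
theorem Pd_X0 : Pd 1 (X 0 : MvPolynomial (Fin 3) K) := (degreeOf_X_self _).le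
theorem Pd_X1 : Pd 0 (X 1 : MvPolynomial (Fin 3) K) := (degreeOf_X_of_ne (by decide)).le
theorem Pd_X2 : Pd 0 (X 2 : MvPolynomial (Fin 3) K) := (degreeOf_X_of_ne (by decide)).le

theorem Pd.cmul {n : ℕ} {f : MvPolynomial (Fin 3) K} (a : K) (hf : Pd n f) : Pd n (C a * f) := by
  simpa using (Pd_C a).mul hf

theorem Pd.pow0 {f : MvPolynomial (Fin 3) K} (hf : Pd 0 f) (n : ℕ) : Pd 0 (f ^ n) := by
  induction n with
  | zero => simpa using Pd_C (1 : K)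
  | succ n ih => rw [pow_succ]; exact ih.mul hf

theorem Pd_X0_pow (n : ℕ) : Pd n (X 0 ^ n : MvPolynomial (Fin 3) K) := (degreeOf_X_self_pow _ _).le

theorem Pd.pd1 {n : ℕ} {f : MvPolynomial (Fin 3) K} (hf : Pd n f) (i : Fin 3) : Pd n (pderiv i f) := by
  rw [Pd_iff] at *
  intro m hm
  rw [coeff_pderiv, hf, zero_mul]
  simp only [Finsupp.add_apply]; omega

theorem Pd.pd0 {n : ℕ} {f : MvPolynomial (Fin 3) K} (hf : Pd (n + 1) f) : Pd n (pderiv 0 f) := by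
  rw [Pd_iff] at *
  intro m hm
  rw [coeff_pderiv, hf, zero_mul]
  simp; omega

theorem Pd.pd00 {f : MvPolynomial (Fin 3) K} (hf : Pd 0 f) : pderiv 0 f = 0 := by
  ext m
  rw [Pd_iff] at hf
  rw [coeff_pderiv, hf, zero_mul, coeff_zero]
  simp

theorem Pd.Dm {n : ℕ} {f : MvPolynomial (Fin 3) K} (hf : Pd n f) : Pd (n + 1) (Dm K f) := by
  rw [Dm_apply]
  refine Pd.add (Pd.add ?_ ?_) ?_
  · cases n with
    | zero => rw [hf.pd00, mul_zero]; simpa using (Pd_C (0 : K)).mono zero_le_one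
    | succ n =>
      have := (Pd.sub (Pd_X0_pow 2) (Pd_X1.mono (by norm_num : 0 ≤ 2))).cmul (12⁻¹ : K) |>.mul hf.pd0
      exact this.mono (by omega)
  · have := (Pd.sub (Pd_X0.mul Pd_X1) (Pd_X2.mono (by norm_num : 0 ≤ 1))).cmul (3⁻¹ : K) |>.mul (hf.pd1 1)
    exact this.mono (by omega)
  · have := (Pd.sub (Pd_X0.mul Pd_X2) ((Pd_X1.pow0 2).mono (by norm_num : 0 ≤ 1))).cmul (2⁻¹ : K) |>.mul (hf.pd1 2)
    exact this.mono (by omega)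

theorem Pd.iter {n : ℕ} {f : MvPolynomial (Fin 3) K} (hf : Pd n f) (r : ℕ) :
    Pd (n + r) ((_root_.Dm K)^[r] f) := by
  induction r with
  | zero => exact hf
  | succ r ih => rw [Function.iterate_succ_apply']; exact ih.Dm

theorem Pd_of_pderiv (p : ℕ) [CharP K p] {n : ℕ} {f : MvPolynomial (Fin 3) K} (hf : Pd n f)
    (hn : n < p) (h0 : pderiv 0 f = 0) : Pd 0 f := by
  rw [Pd_iff] at *
  intro m hm
  by_cases hmn : n < m 0
  · exact hf m hmn
  have h1 := coeff_pderiv (i := 0) f (m - Finsupp.single 0 1)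
  rw [h0, coeff_zero, tsub_add_cancel_of_le (by simp; omega)] at h1
  have h2 : (((m - Finsupp.single 0 1 : Fin 3 →₀ ℕ) 0 : ℕ) : K) + 1 = ((m 0 : ℕ) : K) := by
    simp only [Finsupp.tsub_apply, Finsupp.single_eq_same]
    rw [Nat.cast_sub (by omega)]; simp
  rw [h2] at h1
  rcases mul_eq_zero.mp h1.symm with h | h
  · exact h
  · rw [CharP.cast_eq_zero_iff K p] at h
    exact absurd (Nat.le_of_dvd hm h) (by omega)

/-- coefficient of the top power of `P`. -/
theorem Dm_top (h12 : (12 : K) ≠ 0) {f : MvPolynomial (Fin 3) K} {w : ℕ} (hf : WH f w) (h0 : Pd 0 f) (n : ℕ) :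
    ∃ g : MvPolynomial (Fin 3) K, Pd n g ∧ (Dm K)^[n + 1] f =
      C (∏ j ∈ Finset.range (n + 1), (((w + j : ℕ) : K) * 12⁻¹)) * (X 0 ^ (n + 1) * f) + g := by
  have h2 : (2 : K) ≠ 0 := fun h => h12 (by linear_combination 6 * h)
  have h3 : (3 : K) ≠ 0 := fun h => h12 (by linear_combination 4 * h)
  have e3 : (3⁻¹ : K) = 4 * 12⁻¹ := by field_simp; norm_num
  have e2 : (2⁻¹ : K) = 6 * 12⁻¹ := by field_simp; norm_num
  -- the derivative of f
  set s : MvPolynomial (Fin 3) K := C (3⁻¹ : K) * (- X 2) * pderiv 1 f + C (2⁻¹ : K) * (- X 1 ^ 2) * pderiv 2 f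
    with hs
  have hsP : Pd 0 s := by
    refine Pd.add ?_ ?_
    · exact ((Pd_X2.neg).cmul _).mul (h0.pd1 1)
    · exact (((Pd_X1.pow0 2).neg).cmul _).mul (h0.pd1 2)
  have hDf : Dm K f = C ((w : K) * 12⁻¹) * (X 0 * f) + s := by
    have he := hf.euler
    rw [h0.pd00] at he
    rw [Dm_apply, h0.pd00, hs, C_mul, map_natCast,
      show ((w : MvPolynomial (Fin 3) K) * C (12⁻¹ : K) * (X 0 * f)) = C (12⁻¹ : K) * X 0 * ((w : MvPolynomial (Fin 3) K) * f) by ring,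
      ← he, e3, e2]
    simp only [C_mul, map_ofNat]
    ring
  induction n with
  | zero => exact ⟨s, hsP, by simp [hDf]⟩
  | succ n ih =>
    obtain ⟨g, hg, e⟩ := ih
    rw [Function.iterate_succ_apply', e]
    refine ⟨C (∏ j ∈ Finset.range (n + 1), (((w + j : ℕ) : K) * 12⁻¹)) *
      (X 0 ^ (n + 1) * s - C ((n + 1 : ℕ) : K) * (C (12⁻¹ : K) * (X 0 ^ n * X 1 * f))) + Dm K g, ?_, ?_⟩
    · refine Pd.add (Pd.cmul _ (Pd.sub ((Pd_X0_pow _).mul hsP) (Pd.cmul _ (Pd.cmul _ ?_)))) hg.Dm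
      exact (((Pd_X0_pow n).mul Pd_X1).mul h0).mono (by omega)
    · have hX : Dm K (X 0) = C (12⁻¹ : K) * (X 0 ^ 2 - X 1) := by
        rw [Dm_apply, pderiv_X_self, pderiv_X_of_ne (by decide), pderiv_X_of_ne (by decide)]; ring
      rw [map_add, ← MvPolynomial.smul_eq_C_mul, Derivation.map_smul, Derivation.leibniz, Derivation.leibniz_pow,
        hX, hDf, Finset.prod_range_succ _ (n + 1), MvPolynomial.smul_eq_C_mul]
      simp only [smul_eq_mul, nsmul_eq_mul, C_mul, map_natCast, Nat.add_sub_cancel]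
      push_cast
      ring

/-- modular: weight `w`, no `P`. -/
def MM (w : ℕ) (f : MvPolynomial (Fin 3) K) : Prop := WH f w ∧ Pd 0 f

theorem MM.mul {a b : ℕ} {f g : MvPolynomial (Fin 3) K} (hf : MM a f) (hg : MM b g) :
    MM (a + b) (f * g) := ⟨hf.1.mul hg.1, hf.2.mul hg.2⟩

theorem MM.pow {a : ℕ} {f : MvPolynomial (Fin 3) K} (hf : MM a f) (n : ℕ) :
    MM (n * a) (f ^ n) := ⟨by simpa using hf.1.pow n, hf.2.pow0 n⟩

theorem MM.sub {a : ℕ} {f g : MvPolynomial (Fin 3) K} (hf : MM a f) (hg : MM a g) :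
    MM a (f - g) := ⟨hf.1.sub hg.1, hf.2.sub hg.2⟩

theorem h12_of (p : ℕ) (hp : p.Prime) (hp5 : 5 ≤ p) [CharP K p] : (12 : K) ≠ 0 := by
  intro h
  have h' : ((12 : ℕ) : K) = 0 := by exact_mod_cast h
  rw [CharP.cast_eq_zero_iff K p] at h'
  have : p ∣ 2 ^ 2 * 3 := by simpa using h'
  rcases (hp.dvd_mul).mp this with h | h
  · have := Nat.le_of_dvd (by norm_num) (hp.dvd_of_dvd_pow h); omega
  · have := Nat.le_of_dvd (by norm_num) h; omega

theorem MM.Dp (p : ℕ) (hp : p.Prime) (hp5 : 5 ≤ p) [CharP K p] {w : ℕ} {f : MvPolynomial (Fin 3) K}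
    (hf : MM w f) : MM (w + 2 * p) ((Dm K)^[p] f) := by
  have h12 : (12 : K) ≠ 0 := h12_of p hp hp5
  refine ⟨hf.1.iter p, ?_⟩
  obtain ⟨q, rfl⟩ : ∃ q, p = q + 1 := ⟨p - 1, by omega⟩
  have hd := pderiv_iter h12 hf.1 hf.2.pd00 q
  rw [CharP.cast_eq_zero] at hd
  obtain ⟨g, hg, e⟩ := Dm_top h12 hf.1 hf.2 q
  have hz : ∏ j ∈ Finset.range (q + 1), (((w + j : ℕ) : K) * 12⁻¹) = 0 := by
    have hw := Nat.mod_lt w (show 0 < q + 1 by omega)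
    rw [Finset.prod_eq_zero_iff]
    by_cases hw0 : w % (q + 1) = 0
    · refine ⟨0, by simp, ?_⟩
      rw [(CharP.cast_eq_zero_iff K (q + 1) (w + 0)).mpr (Nat.dvd_of_mod_eq_zero hw0), zero_mul]
    · refine ⟨q + 1 - w % (q + 1), by simp; omega, ?_⟩
      rw [(CharP.cast_eq_zero_iff K (q + 1) _).mpr, zero_mul]
      refine ⟨w / (q + 1) + 1, ?_⟩
      have := Nat.div_add_mod w (q + 1)
      rw [mul_add, mul_one]; omega
  rw [hz] at e
  simp only [map_zero, zero_mul, zero_add] at e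
  refine Pd_of_pderiv (q + 1) (n := q) ?_ (by omega) ?_
  · rw [e]; exact hg
  · rw [hd]; simp

theorem MM.Dn (p : ℕ) (hp : p.Prime) (hp5 : 5 ≤ p) [CharP K p] {w n : ℕ} {f : MvPolynomial (Fin 3) K}
    (hf : MM w f) (hn : n < p) (hwn : w + n = p + 1) : MM (w + 2 * n) ((Dm K)^[n] f) := by
  have h12 : (12 : K) ≠ 0 := h12_of p hp hp5
  refine ⟨hf.1.iter n, ?_⟩
  cases n with
  | zero => exact hf.2
  | succ n =>
    have hd := pderiv_iter h12 hf.1 hf.2.pd00 n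
    rw [show w + n = p by omega, CharP.cast_eq_zero K p] at hd
    refine Pd_of_pderiv p (n := 0 + (n + 1)) (hf.2.iter _) (by omega) ?_
    rw [hd]; simp

theorem MM.Dpm (p : ℕ) (hp : p.Prime) (hp5 : 5 ≤ p) [CharP K p] {w : ℕ} {f : MvPolynomial (Fin 3) K}
    (hf : MM w f) (m : ℕ) : MM (w + 2 * (p * m)) ((Dm K)^[p * m] f) := by
  induction m with
  | zero => exact hf
  | succ m ih =>
    have := ih.Dp p hp hp5
    rw [← Function.iterate_add_apply] at this
    rw [show p * (m + 1) = p + p * m by ring]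
    rwa [show w + 2 * (p + p * m) = w + 2 * (p * m) + 2 * p by ring]

/-- the theta operator -/
theorem MM.theta (p : ℕ) (hp : p.Prime) (hp5 : 5 ≤ p) [CharP K p] {w : ℕ} {f A : MvPolynomial (Fin 3) K}
    (hA : MM (p - 1) A) (hf : MM w f) :
    MM (w + (p + 1)) (A * Dm K f + C (w : K) * (f * Dm K A)) := by
  have h12 : (12 : K) ≠ 0 := h12_of p hp hp5
  have hP : Pd 1 (A * Dm K f + C (w : K) * (f * Dm K A)) :=
    Pd.add (by simpa using hA.2.mul hf.2.Dm) (Pd.cmul _ (by simpa using hf.2.mul hA.2.Dm))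
  refine ⟨?_, ?_⟩
  · refine IsWeightedHomogeneous.add ?_ (IsWeightedHomogeneous.C_mul ?_ _)
    · have := hA.1.mul hf.1.Dm
      rwa [show p - 1 + (w + 2) = w + (p + 1) by omega] at this
    · have := hf.1.mul hA.1.Dm
      rwa [show w + (p - 1 + 2) = w + (p + 1) by omega] at this
  · refine Pd_of_pderiv p hP (by omega) ?_
    rw [map_add, pderiv_C_mul, Derivation.leibniz, Derivation.leibniz, comm_pderiv h12 hf.1,
      comm_pderiv h12 hA.1, hf.2.pd00, hA.2.pd00]
    have : ((p - 1 : ℕ) : K) = -1 := by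
      rw [Nat.cast_sub (by omega), CharP.cast_eq_zero]; simp
    rw [this]
    simp only [smul_eq_mul, map_zero, zero_add, C_mul, map_neg, map_one, mul_zero, add_zero]
    ring

end modp
section modp2
variable {K : Type*} [Field K]

theorem transc {s : PowerSeries K} (hs0 : PowerSeries.constantCoeff s = 0) (hs : s ≠ 0) :
    ∀ (n : ℕ) (h : Polynomial K), h.natDegree < n → Polynomial.aeval s h = 0 → h = 0 := by
  intro n
  induction n with
  | zero => intro h hn; omega
  | succ n ih =>
    intro h hn hz
    have e := Polynomial.divX_mul_X_add h
    rw [← e, map_add, map_mul, Polynomial.aeval_X, Polynomial.aeval_C] at hz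
    have h0 : h.coeff 0 = 0 := by
      have := congrArg PowerSeries.constantCoeff hz
      rw [map_add, map_mul, hs0] at this
      simpa [PowerSeries.algebraMap_apply] using this
    rw [h0, map_zero, add_zero] at hz
    have hz' : Polynomial.aeval s h.divX = 0 := (mul_eq_zero.mp hz).resolve_right hs
    by_cases hd : h.natDegree = 0
    · rw [Polynomial.eq_C_of_natDegree_eq_zero hd, h0, map_zero]
    have : h.divX = 0 := ih _ (by rw [Polynomial.natDegree_divX_eq_natDegree_tsub_one]; omega) hz'
    rw [← e, this, h0]; simp

theorem transc1 {t : PowerSeries K} (ht0 : PowerSeries.constantCoeff t = 1) (ht : t ≠ 1)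
    (h : Polynomial K) (hz : Polynomial.aeval t h = 0) : h = 0 := by
  have h1 : Polynomial.aeval (t - 1) (h.comp (Polynomial.X + 1)) = 0 := by
    rw [Polynomial.aeval_comp]; simpa using hz
  have h2 := transc (s := t - 1) (by simp [ht0]) (sub_ne_zero.mpr ht) _ _ (Nat.lt_succ_self _) h1
  have h3 := congrArg (fun q => q.comp (Polynomial.X - 1)) h2
  simpa [Polynomial.comp_assoc] using h3

/-- data of mod `p` Eisenstein series -/
structure EData (e2 e4 e6 : PowerSeries K) : Prop where
  c4 : PowerSeries.constantCoeff e4 = 1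
  c6 : PowerSeries.constantCoeff e6 = 1
  ne : e4 ^ 3 ≠ e6 ^ 2
  r2 : thD K e2 = (12⁻¹ : K) • (e2 ^ 2 - e4)
  r4 : thD K e4 = (3⁻¹ : K) • (e2 * e4 - e6)
  r6 : thD K e6 = (2⁻¹ : K) • (e2 * e6 - e4 ^ 2)

variable {e2 e4 e6 : PowerSeries K}

/-- evaluation -/
def Psi (e2 e4 e6 : PowerSeries K) : MvPolynomial (Fin 3) K →ₐ[K] PowerSeries K :=
  aeval ![e2, e4, e6]

theorem Psi_D (E : EData e2 e4 e6) (f : MvPolynomial (Fin 3) K) :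
    Psi e2 e4 e6 (Dm K f) = thD K (Psi e2 e4 e6 f) := by
  have hX : ∀ i, Psi e2 e4 e6 (X i) = ![e2, e4, e6] i := fun i => aeval_X _ _
  have hC : ∀ a, Psi e2 e4 e6 (C a) = algebraMap K _ a := fun a => aeval_C _ _
  induction f using MvPolynomial.induction_on with
  | C a =>
    rw [hC, Derivation.map_algebraMap]
    have : (C a : MvPolynomial (Fin 3) K) = algebraMap K _ a := rfl
    rw [this, Derivation.map_algebraMap, map_zero]
  | add f g hf hg => rw [map_add, map_add, map_add, map_add, hf, hg]
  | mul_X f i hf =>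
    have key : Psi e2 e4 e6 (Dm K (X i)) = thD K (Psi e2 e4 e6 (X i)) := by
      rw [Dm_apply]
      fin_cases i
      · simp only [Fin.zero_eta, pderiv_X_self, pderiv_X_of_ne (show (0 : Fin 3) ≠ 1 by decide),
          pderiv_X_of_ne (show (0 : Fin 3) ≠ 2 by decide), hX, map_add, map_mul, map_sub, map_pow, hC, map_one, map_zero]
        simp [E.r2, Algebra.smul_def]
      · simp only [Fin.mk_one, pderiv_X_self, pderiv_X_of_ne (show (1 : Fin 3) ≠ 0 by decide),
          pderiv_X_of_ne (show (1 : Fin 3) ≠ 2 by decide), hX, map_add, map_mul, map_sub, map_pow, hC, map_one, map_zero]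
        simp [E.r4, Algebra.smul_def]
      · simp only [Fin.reduceFinMk, pderiv_X_self, pderiv_X_of_ne (show (2 : Fin 3) ≠ 0 by decide),
          pderiv_X_of_ne (show (2 : Fin 3) ≠ 1 by decide), hX, map_add, map_mul, map_sub, map_pow, hC, map_one, map_zero]
        simp [E.r6, Algebra.smul_def]
    rw [Derivation.leibniz, map_mul, Derivation.leibniz, map_add, smul_eq_mul, smul_eq_mul, map_mul, map_mul, hf, key,
      smul_eq_mul, smul_eq_mul]

theorem Psi_iter (E : EData e2 e4 e6) (f : MvPolynomial (Fin 3) K) (n : ℕ) :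
    Psi e2 e4 e6 ((Dm K)^[n] f) = (thD K)^[n] (Psi e2 e4 e6 f) := by
  induction n with
  | zero => rfl
  | succ n ih => rw [Function.iterate_succ_apply', Function.iterate_succ_apply', Psi_D E, ih]

theorem coeff_thD_iter (f : PowerSeries K) (n m : ℕ) :
    PowerSeries.coeff m ((thD K)^[n] f) = (m : K) ^ n * PowerSeries.coeff m f := by
  induction n with
  | zero => simp
  | succ n ih => rw [Function.iterate_succ_apply', coeff_thD, ih]; ring

theorem thD_p (p : ℕ) (hp : p.Prime) [CharP K p] (f : PowerSeries K) (m : ℕ) :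
    (thD K)^[p * m] f = (thD K)^[m] f := by
  ext j
  have : Fact p.Prime := ⟨hp⟩
  rw [coeff_thD_iter, coeff_thD_iter, pow_mul]
  congr 2
  have h : ((j : ZMod p)) ^ p = j := ZMod.pow_card _
  have h2 := congrArg (ZMod.castHom (dvd_refl p) K) h
  rw [map_pow, map_natCast] at h2
  exact h2

theorem Psi_inj (E : EData e2 e4 e6) {w : ℕ} {f : MvPolynomial (Fin 3) K} (hf : MM w f)
    (h0 : Psi e2 e4 e6 f = 0) : f = 0 := by
  have hsup : ∀ m ∈ f.support, m 0 = 0 ∧ 4 * m 1 + 6 * m 2 = w := by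
    intro m hm
    have h1 : m 0 = 0 := by
      have := degreeOf_le_iff.mp hf.2 m hm
      omega
    have h2 := hf.1 (mem_support_iff.mp hm)
    rw [Finsupp.weight_apply, Finsupp.sum_fintype _ _ (by simp)] at h2
    simp [Fin.sum_univ_three, h1] at h2
    exact ⟨h1, by omega⟩
  -- inverse of e4
  set v := e4⁻¹ with hv
  have hve : e4 * v = 1 := PowerSeries.mul_inv_cancel _ (by rw [E.c4]; exact one_ne_zero)
  set t := e6 ^ 2 * v ^ 3 with ht
  have hv0 : PowerSeries.constantCoeff v = 1 := by
    have := congrArg PowerSeries.constantCoeff hve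
    simpa [E.c4] using this
  have ht0 : PowerSeries.constantCoeff t = 1 := by simp [ht, hv0, E.c6]
  have ht1 : t ≠ 1 := by
    intro h
    apply E.ne
    have h3 : e4 ^ 3 * v ^ 3 = 1 := by rw [← mul_pow, hve, one_pow]
    calc e4 ^ 3 = e4 ^ 3 * t := by rw [h, mul_one]
      _ = e6 ^ 2 * (e4 ^ 3 * v ^ 3) := by rw [ht]; ring
      _ = e6 ^ 2 := by rw [h3, mul_one]
  set c0 := (w / 2) % 2 with hc0
  set b0 := (w - 6 * c0) / 4 with hb0
  set g : Polynomial K := ∑ m ∈ f.support, Polynomial.monomial (m 2 / 2) (coeff m f) with hg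
  have hPsi : Psi e2 e4 e6 f = e6 ^ c0 * e4 ^ b0 * Polynomial.aeval t g := by
    rw [Psi, aeval_def, eval₂_eq', hg, map_sum, Finset.mul_sum]
    refine Finset.sum_congr rfl fun m hm => ?_
    obtain ⟨m0, mw⟩ := hsup m hm
    rw [Polynomial.aeval_monomial, Fin.prod_univ_three, m0]
    simp only [Matrix.cons_val_zero, Matrix.cons_val_one, Matrix.cons_val, pow_zero, one_mul]
    have a1 : m 2 = c0 + 2 * (m 2 / 2) := by omega
    have a2 : b0 = m 1 + 3 * (m 2 / 2) := by omega
    have hh : e6 ^ m 2 = e6 ^ c0 * (e6 ^ 2) ^ (m 2 / 2) := by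
      rw [← pow_mul, ← pow_add, ← a1]
    have hk : e4 ^ b0 * (v ^ 3) ^ (m 2 / 2) = e4 ^ m 1 := by
      rw [a2, pow_add, mul_assoc, ← pow_mul, ← mul_pow, hve, one_pow, mul_one]
    rw [hh, ← hk, ht, mul_pow]
    ring
  have hu : e6 ^ c0 * e4 ^ b0 ≠ 0 := by
    intro h
    have := congrArg PowerSeries.constantCoeff h
    simp [E.c4, E.c6] at this
  rw [hPsi] at h0
  have hg0 : g = 0 := transc1 ht0 ht1 g ((mul_eq_zero.mp h0).resolve_left hu)
  by_contra hne
  obtain ⟨m, hm⟩ := support_nonempty.mpr hne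
  have h1 := congrArg (fun q => Polynomial.coeff q (m 2 / 2)) hg0
  simp only [hg, Polynomial.finsetSum_coeff, Polynomial.coeff_zero, Polynomial.coeff_monomial] at h1
  rw [Finset.sum_eq_single m] at h1
  · rw [if_pos rfl] at h1
    exact mem_support_iff.mp hm h1
  · intro m' hm' hmm
    rw [if_neg]
    intro h
    apply hmm
    have x1 := hsup m hm
    have x2 := hsup m' hm'
    ext i
    fin_cases i
    · exact x2.1.trans x1.1.symm
    · show m' 1 = m 1
      omega
    · show m' 2 = m 2
      omega
  · intro h; exact absurd hm h

theorem modp_main (E : EData e2 e4 e6) (p : ℕ) (hp : p.Prime) (hp5 : 5 ≤ p) [CharP K p]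
    {A f : MvPolynomial (Fin 3) K} (hA : MM (p - 1) A) (hA1 : Psi e2 e4 e6 A = 1)
    {k : ℕ} (hk4 : 4 ≤ k) (hkp : k ≤ p + 1) (hf : MM k f) (i : ℕ) (hi : i ≤ k - 1) :
    ∃ G, (Dm K)^[p ^ 2 - i * p] f = A ^ (2 * p + 1 - k - i) * G := by
  have hth : ∀ r : ℕ, ∃ g, MM (k + 2 * (p + 1 - k) + (p + 1) * r) g ∧
      Psi e2 e4 e6 g = (thD K)^[r] (Psi e2 e4 e6 ((Dm K)^[p + 1 - k] f)) := by
    intro r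
    induction r with
    | zero => exact ⟨_, hf.Dn p hp hp5 (by omega) (by omega), rfl⟩
    | succ r ih =>
      obtain ⟨g, hg, hg2⟩ := ih
      refine ⟨A * Dm K g + C (((k + 2 * (p + 1 - k) + (p + 1) * r : ℕ)) : K) * (g * Dm K A), ?_, ?_⟩
      · have := MM.theta p hp hp5 hA hg
        rw [mul_add, mul_one, ← add_assoc]
        exact this
      · rw [map_add, map_mul, map_mul, map_mul, Psi_D E, Psi_D E, hA1, hg2, Function.iterate_succ_apply']
        simp
  by_cases hip : p ≤ i
  · -- `i = p`, `k = p + 1`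
    have : 2 * p + 1 - k - i = 0 := by omega
    rw [this]
    exact ⟨_, (one_mul _).symm⟩
  obtain ⟨g, hg, hg2⟩ := hth (k - 1 - i)
  obtain ⟨m, rfl⟩ : ∃ m, p = i + m := ⟨p - i, by omega⟩
  have hpm : (i + m) ^ 2 - i * (i + m) = (i + m) * m := by
    rw [Nat.sub_eq_iff_eq_add (by nlinarith)]; ring
  rw [hpm]
  refine ⟨g, ?_⟩
  rw [← sub_eq_zero]
  have h1 := hf.Dpm (i + m) hp hp5 m
  have h2 := (hA.pow (2 * (i + m) + 1 - k - i)).mul hg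
  refine Psi_inj E (w := k + 2 * ((i + m) * m)) (MM.sub h1 ?_) ?_
  · convert h2 using 1
    obtain ⟨r, hr⟩ : ∃ r, k = i + 1 + r := ⟨k - (i + 1), by omega⟩
    obtain ⟨n, hn⟩ : ∃ n, m = r + n := ⟨m - r, by omega⟩
    subst hr hn
    have a1 : 2 * (i + (r + n)) + 1 - (i + 1 + r) - i = r + 2 * n := by omega
    have a2 : i + (r + n) + 1 - (i + 1 + r) = n := by omega
    have a3 : i + 1 + r - 1 - i = r := by omega
    rw [a1, a2, a3]
    have a4 : i + (r + n) = (i + (r + n) - 1) + 1 := by omega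
    generalize i + (r + n) - 1 = q at *
    have a5 : i = q + 1 - r - n := by omega
    zify [show r + n ≤ q + 1 by omega] at *
    have a6 : (i : ℤ) = q + 1 - r - n := by omega
    rw [a6]
    ring
  · rw [map_sub, map_mul, map_pow, hA1, hg2, Psi_iter E, Psi_iter E, thD_p _ hp,
      ← Function.iterate_add_apply]
    rw [show k - 1 - i + (i + m + 1 - k) = m by omega]
    simp
end modp2
section transfer

/-- The subring of `p`-integral rationals. -/
def Zp (p : ℕ) [hp : Fact p.Prime] : Subring ℚ where
  carrier := {x | pInt p x}
  mul_mem' := by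
    intro a b ha hb h
    rcases (hp.out.dvd_mul).mp (h.trans (Rat.mul_den_dvd a b)) with h | h
    · exact ha h
    · exact hb h
  one_mem' := by
    intro h
    exact hp.out.one_lt.ne' (Nat.dvd_one.mp (by simpa using h))
  add_mem' := by
    intro a b ha hb h
    rcases (hp.out.dvd_mul).mp (h.trans (Rat.add_den_dvd a b)) with h | h
    · exact ha h
    · exact hb h
  zero_mem' := by
    intro h
    exact hp.out.one_lt.ne' (Nat.dvd_one.mp (by simpa using h))
  neg_mem' := by
    intro a ha h
    exact ha (by simpa using h)

variable {p : ℕ} [hp : Fact p.Prime]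

theorem mem_Zp {x : ℚ} : x ∈ Zp p ↔ pInt p x := Iff.rfl

theorem den_ne {x : ℚ} (hx : x ∈ Zp p) : (x.den : ZMod p) ≠ 0 := by
  intro h
  exact hx ((ZMod.natCast_eq_zero_iff _ _).mp h)

/-- Reduction modulo `p`. -/
def red (p : ℕ) [hp : Fact p.Prime] : Zp p →+* ZMod p where
  toFun x := ((x : ℚ) : ZMod p)
  map_one' := by simp
  map_zero' := by simp
  map_add' a b := by
    simpa using Rat.cast_add_of_ne_zero (den_ne a.2) (den_ne b.2)
  map_mul' a b := by
    simpa using Rat.cast_mul_of_ne_zero (den_ne a.2) (den_ne b.2)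

theorem inv_mem {x : ℚ} (hx : x ∈ Zp p) (h : red p ⟨x, hx⟩ ≠ 0) : x⁻¹ ∈ Zp p := by
  intro h1
  apply h
  have hx0 : x ≠ 0 := by
    rintro rfl
    exact h (by simp [red])
  rw [Rat.inv_def, ] at h1
  have h2 : (p : ℤ) ∣ x.num := by
    have h3 := Rat.den_inv_of_ne_zero hx0
    rw [← Rat.inv_def, h3] at h1
    exact Int.natCast_dvd.mpr h1
  change ((x : ℚ) : ZMod p) = 0
  rw [Rat.cast_def, (ZMod.intCast_zmod_eq_zero_iff_dvd _ _).mpr h2, zero_div]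

theorem int_mem (a : ℤ) : (a : ℚ) ∈ Zp p := intCast_mem _ a

theorem nat_mem (a : ℕ) : (a : ℚ) ∈ Zp p := natCast_mem _ a

theorem nat_inv_mem (a : ℕ) (h : ¬ p ∣ a) : (a : ℚ)⁻¹ ∈ Zp p := by
  refine inv_mem (nat_mem a) ?_
  change (((a : ℚ)) : ZMod p) ≠ 0
  rw [Rat.cast_natCast]
  intro h1
  exact h ((ZMod.natCast_eq_zero_iff _ _).mp h1)

theorem red_ker {x : Zp p} (h : red p x = 0) : ∃ y : Zp p, x = p * y := by
  have h1 : ((x : ℚ) : ZMod p) = 0 := h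
  rw [Rat.cast_def, div_eq_zero_iff] at h1
  have h2 := h1.resolve_right (den_ne x.2)
  rw [ZMod.intCast_zmod_eq_zero_iff_dvd] at h2
  obtain ⟨c, hc⟩ := h2
  refine ⟨⟨(c : ℚ) * ((x : ℚ).den : ℚ)⁻¹, (Zp p).mul_mem (int_mem c) (nat_inv_mem _ x.2)⟩, ?_⟩
  apply Subtype.ext
  push_cast
  have h3 := Rat.num_div_den (x : ℚ)
  rw [hc] at h3
  have h4 : ((x : ℚ).den : ℚ) ≠ 0 := by exact_mod_cast (x : ℚ).den_nz
  rw [div_eq_mul_inv] at h3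
  push_cast at h3
  rw [← mul_assoc]
  exact h3.symm

theorem red_surj (y : ZMod p) : ∃ x : Zp p, red p x = y := by
  refine ⟨(y.val : Zp p), ?_⟩
  rw [map_natCast, ZMod.natCast_zmod_val]

theorem poly_lift {f : Poly3} (hf : polyPInt p f) :
    ∃ g : MvPolynomial (Fin 3) (Zp p), MvPolynomial.map (Zp p).subtype g = f := by
  refine ⟨∑ m ∈ f.support, monomial m (⟨coeff m f, hf m⟩ : Zp p), ?_⟩
  rw [map_sum]
  simp only [map_monomial, Subring.subtype_apply]
  exact support_sum_monomial_coeff f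

theorem poly_int (g : MvPolynomial (Fin 3) (Zp p)) :
    polyPInt p (MvPolynomial.map (Zp p).subtype g) := by
  intro m
  rw [coeff_map]
  exact (coeff m g).2

theorem poly_ker {g : MvPolynomial (Fin 3) (Zp p)} (h : MvPolynomial.map (red p) g = 0) :
    ∃ H, g = (p : MvPolynomial (Fin 3) (Zp p)) * H := by
  have h1 : ∀ m, ∃ y : Zp p, coeff m g = p * y := by
    intro m
    apply red_ker
    rw [← coeff_map, h, coeff_zero]
  choose y hy using h1
  refine ⟨∑ m ∈ g.support, monomial m (y m), ?_⟩
  conv_lhs => rw [← support_sum_monomial_coeff g]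
  rw [Finset.mul_sum]
  refine Finset.sum_congr rfl fun m _ => ?_
  rw [hy m, ← map_natCast (C : Zp p →+* MvPolynomial (Fin 3) (Zp p)), C_mul_monomial]

/-- The derivation over `Zp`. -/
def DZ (u : Zp p) (f : MvPolynomial (Fin 3) (Zp p)) : MvPolynomial (Fin 3) (Zp p) :=
  C u * (X 0 ^ 2 - X 1) * pderiv 0 f
    + C (4 * u) * (X 0 * X 1 - X 2) * pderiv 1 f
    + C (6 * u) * (X 0 * X 2 - X 1 ^ 2) * pderiv 2 f

theorem DZ_map {K : Type*} [Field K] (h12 : (12 : K) ≠ 0) (φ : Zp p →+* K) (u : Zp p)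
    (hu : 12 * u = 1) (f : MvPolynomial (Fin 3) (Zp p)) :
    MvPolynomial.map φ (DZ u f) = Dm K (MvPolynomial.map φ f) := by
  have h3 : (3 : K) ≠ 0 := by rintro h; apply h12; linear_combination 4 * h
  have h2 : (2 : K) ≠ 0 := by rintro h; apply h12; linear_combination 6 * h
  have e : 12 * φ u = 1 := by
    have := congrArg φ hu
    rwa [map_mul, map_one, map_ofNat] at this
  have e1 : φ u = 12⁻¹ := by field_simp; linear_combination e
  have e2 : φ (4 * u) = 3⁻¹ := by
    rw [map_mul, map_ofNat]; field_simp; linear_combination e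
  have e3 : φ (6 * u) = 2⁻¹ := by
    rw [map_mul, map_ofNat]; field_simp; linear_combination e
  rw [Dm_apply, DZ]
  rw [← e1, ← e2, ← e3]
  simp only [map_add, map_mul, map_sub, map_pow, map_C, map_X, pderiv_map]

theorem Dop_eq (f : Poly3) : Dop f = Dm ℚ f := by
  rw [Dop, Dm_apply]
  norm_num

theorem DZ_iter {K : Type*} [Field K] (h12 : (12 : K) ≠ 0) (φ : Zp p →+* K) (u : Zp p)
    (hu : 12 * u = 1) (f : MvPolynomial (Fin 3) (Zp p)) (n : ℕ) :
    MvPolynomial.map φ ((DZ u)^[n] f) = (Dm K)^[n] (MvPolynomial.map φ f) := by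
  induction n with
  | zero => rfl
  | succ n ih => rw [Function.iterate_succ_apply', Function.iterate_succ_apply', DZ_map h12 φ u hu, ih]

/-- Divisor sum, integer version. -/
def sgZ (j n : ℕ) : ℤ := ∑ d ∈ n.divisors, (d : ℤ) ^ j

/-- integral Eisenstein series -/
def e2Z : PowerSeries ℤ := PowerSeries.mk fun n => if n = 0 then 1 else -24 * sgZ 1 n
/-- integral Eisenstein series -/
def e4Z : PowerSeries ℤ := PowerSeries.mk fun n => if n = 0 then 1 else 240 * sgZ 3 n
/-- integral Eisenstein series -/
def e6Z : PowerSeries ℤ := PowerSeries.mk fun n => if n = 0 then 1 else -504 * sgZ 5 n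

/-- base change -/
def bc (T : Type*) [CommRing T] (e : PowerSeries ℤ) : PowerSeries T :=
  PowerSeries.map (Int.castRingHom T) e

theorem e2Q : bc ℚ e2Z = E2s := by
  ext n; simp [bc, e2Z, E2s, sgZ, sigmaQ]
theorem e4Q : bc ℚ e4Z = E4s := by
  ext n; simp [bc, e4Z, E4s, sgZ, sigmaQ]
theorem e6Q : bc ℚ e6Z = E6s := by
  ext n; simp [bc, e6Z, E6s, sgZ, sigmaQ]

theorem bc_inj : Function.Injective (bc ℚ) := by
  intro a b h
  ext n
  have := congrArg (PowerSeries.coeff n) h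
  simpa [bc] using this

theorem bc_thD (T : Type*) [CommRing T] (e : PowerSeries ℤ) : bc T (thD ℤ e) = thD T (bc T e) := by
  ext n
  rw [coeff_thD, bc, bc, PowerSeries.coeff_map, PowerSeries.coeff_map, coeff_thD]
  simp

theorem ram2Z : 12 * thD ℤ e2Z = e2Z ^ 2 - e4Z := by
  apply bc_inj
  have h : bc ℚ (12 * thD ℤ e2Z) = 12 * bc ℚ (thD ℤ e2Z) := by
    rw [bc, map_mul, map_ofNat]; rfl
  rw [h, bc_thD, e2Q, ram2]
  have h2 : bc ℚ (e2Z ^ 2 - e4Z) = bc ℚ e2Z ^ 2 - bc ℚ e4Z := by simp [bc]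
  rw [h2, e2Q, e4Q]
  ext n
  rw [show (12 : PowerSeries ℚ) = PowerSeries.C 12 from (map_ofNat _ _).symm, PowerSeries.coeff_C_mul,
    PowerSeries.coeff_smul, ← pow_two, smul_eq_mul]
  ring

theorem ram4Z : 3 * thD ℤ e4Z = e2Z * e4Z - e6Z := by
  apply bc_inj
  have h : bc ℚ (3 * thD ℤ e4Z) = 3 * bc ℚ (thD ℤ e4Z) := by
    rw [bc, map_mul, map_ofNat]; rfl
  rw [h, bc_thD, e4Q, ram4]
  have h2 : bc ℚ (e2Z * e4Z - e6Z) = bc ℚ e2Z * bc ℚ e4Z - bc ℚ e6Z := by simp [bc]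
  rw [h2, e2Q, e4Q, e6Q]
  ext n
  rw [show (3 : PowerSeries ℚ) = PowerSeries.C 3 from (map_ofNat _ _).symm, PowerSeries.coeff_C_mul,
    PowerSeries.coeff_smul, smul_eq_mul]
  ring

theorem ram6Z : 2 * thD ℤ e6Z = e2Z * e6Z - e4Z ^ 2 := by
  apply bc_inj
  have h : bc ℚ (2 * thD ℤ e6Z) = 2 * bc ℚ (thD ℤ e6Z) := by
    rw [bc, map_mul, map_ofNat]; rfl
  rw [h, bc_thD, e6Q, ram6]
  have h2 : bc ℚ (e2Z * e6Z - e4Z ^ 2) = bc ℚ e2Z * bc ℚ e6Z - bc ℚ e4Z ^ 2 := by simp [bc]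
  rw [h2, e2Q, e4Q, e6Q]
  ext n
  rw [show (2 : PowerSeries ℚ) = PowerSeries.C 2 from (map_ofNat _ _).symm, PowerSeries.coeff_C_mul,
    PowerSeries.coeff_smul, ← pow_two, smul_eq_mul]
  ring

theorem smul_of {K : Type*} [Field K] {a : K} (ha : a ≠ 0) {x y : PowerSeries K}
    (h : PowerSeries.C a * x = y) : x = a⁻¹ • y := by
  rw [← h, ← PowerSeries.smul_eq_C_mul, smul_smul, inv_mul_cancel₀ ha, one_smul]

theorem coeffOnePow {T : Type*} [CommRing T] (f : PowerSeries T)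
    (h : PowerSeries.constantCoeff f = 1) (n : ℕ) :
    PowerSeries.coeff 1 (f ^ n) = n * PowerSeries.coeff 1 f := by
  induction n with
  | zero => simp [PowerSeries.coeff_one]
  | succ n ih =>
    rw [pow_succ, PowerSeries.coeff_one_mul, ih, map_pow, h]
    push_cast; ring

theorem edata {K : Type*} [Field K] (h12 : (12 : K) ≠ 0) :
    EData (bc K e2Z) (bc K e4Z) (bc K e6Z) := by
  have h3 : (3 : K) ≠ 0 := by rintro h; apply h12; linear_combination 4 * h
  have h2 : (2 : K) ≠ 0 := by rintro h; apply h12; linear_combination 6 * h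
  have c4 : PowerSeries.constantCoeff (bc K e4Z) = 1 := by
    rw [← PowerSeries.coeff_zero_eq_constantCoeff_apply, bc, PowerSeries.coeff_map]
    simp [e4Z]
  have c6 : PowerSeries.constantCoeff (bc K e6Z) = 1 := by
    rw [← PowerSeries.coeff_zero_eq_constantCoeff_apply, bc, PowerSeries.coeff_map]
    simp [e6Z]
  refine ⟨c4, c6, ?_, ?_, ?_, ?_⟩
  · intro h
    have h1 := congrArg (PowerSeries.coeff 1) h
    rw [coeffOnePow _ c4, coeffOnePow _ c6, bc, bc, PowerSeries.coeff_map,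
      PowerSeries.coeff_map] at h1
    simp [e4Z, e6Z, sgZ] at h1
    have : (12 : K) ^ 3 = 0 := by linear_combination h1
    exact h12 (pow_eq_zero_iff (by norm_num) |>.mp this)
  · refine smul_of h12 ?_
    have := congrArg (bc K) ram2Z
    rw [← bc_thD, map_ofNat]
    rw [bc, map_mul, map_ofNat] at this
    simpa [bc] using this
  · refine smul_of h3 ?_
    have := congrArg (bc K) ram4Z
    rw [← bc_thD, map_ofNat]
    rw [bc, map_mul, map_ofNat] at this
    simpa [bc] using this
  · refine smul_of h2 ?_
    have := congrArg (bc K) ram6Z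
    rw [← bc_thD, map_ofNat]
    rw [bc, map_mul, map_ofNat] at this
    simpa [bc] using this

theorem Psi_map {S T : Type*} [CommRing S] [CommRing T] (φ : S →+* T)
    (g : MvPolynomial (Fin 3) S) :
    PowerSeries.map φ (aeval ![bc S e2Z, bc S e4Z, bc S e6Z] g)
      = aeval ![bc T e2Z, bc T e4Z, bc T e6Z] (MvPolynomial.map φ g) := by
  have hb : ∀ e, PowerSeries.map φ (bc S e) = bc T e := by
    intro e; ext n; simp [bc]
  induction g using MvPolynomial.induction_on with
  | C a =>
    rw [map_C, aeval_C, aeval_C, PowerSeries.algebraMap_apply, PowerSeries.algebraMap_apply]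
    simp
  | add a b ha hb => simp only [map_add, ha, hb]
  | mul_X a i ha =>
    rw [map_mul, map_mul, map_mul, map_mul, ha, map_X, aeval_X, aeval_X]
    congr 1
    fin_cases i <;> simp [hb]

theorem bern (hp5 : 5 ≤ p) : ((p : ℚ) * bernoulli (p - 1))⁻¹ ∈ Zp p := by
  obtain ⟨k, hk⟩ : ∃ k, p - 1 = 2 * k := by
    have := hp.out.odd_of_ne_two (by omega)
    obtain ⟨k, hk⟩ := this
    exact ⟨k, by omega⟩
  obtain ⟨N, hN⟩ := Bernoulli.vonStaudt_clausen k
  have hmem : p ∈ Finset.filter (fun q => q.Prime ∧ (q - 1) ∣ 2 * k) (range (2 * k + 2)) := by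
    rw [Finset.mem_filter, Finset.mem_range]
    exact ⟨by omega, hp.out, by rw [hk]⟩
  rw [← Finset.add_sum_erase _ _ hmem] at hN
  have hz : ∑ q ∈ (Finset.filter (fun q => q.Prime ∧ (q - 1) ∣ 2 * k) (range (2 * k + 2))).erase p,
      (1 : ℚ) / q ∈ Zp p := by
    refine Subring.sum_mem _ fun q hq => ?_
    rw [Finset.mem_erase, Finset.mem_filter] at hq
    rw [one_div]
    refine nat_inv_mem q fun h => hq.1 ?_
    exact ((Nat.prime_dvd_prime_iff_eq hp.out hq.2.2.1).mp h).symm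
  generalize ∑ q ∈ (Finset.filter (fun q => q.Prime ∧ (q - 1) ∣ 2 * k)
    (range (2 * k + 2))).erase p, (1 : ℚ) / q = z at hN hz
  rw [hk]
  have hp0 : (p : ℚ) ≠ 0 := by exact_mod_cast hp.out.ne_zero
  have hB : (p : ℚ) * bernoulli (2 * k) = (p : ℚ) * (N - z) - 1 := by
    rw [hN]; field_simp; ring
  have hw : (N : ℚ) - z ∈ Zp p := (Zp p).sub_mem (int_mem N) hz
  rw [hB]
  refine inv_mem ((Zp p).sub_mem ((Zp p).mul_mem (nat_mem p) hw) (Zp p).one_mem) ?_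
  have : (⟨(p : ℚ) * (N - z) - 1, (Zp p).sub_mem ((Zp p).mul_mem (nat_mem p) hw) (Zp p).one_mem⟩ : Zp p)
      = (p : Zp p) * ⟨_, hw⟩ - 1 := by
    apply Subtype.ext; push_cast; rfl
  rw [this]
  simp

theorem EA_red (hp5 : 5 ≤ p) (s : PowerSeries (Zp p))
    (h : PowerSeries.map (Zp p).subtype s = EAs p) : PowerSeries.map (red p) s = 1 := by
  ext n
  rw [PowerSeries.coeff_map, PowerSeries.coeff_one]
  have h1 := congrArg (PowerSeries.coeff n) h
  rw [PowerSeries.coeff_map, EAs, PowerSeries.coeff_mk, Subring.subtype_apply] at h1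
  split_ifs at h1 ⊢ with hn
  · have : PowerSeries.coeff n s = 1 := Subtype.ext h1
    rw [this, map_one]
  · have hs : sigmaQ (p - 2) n ∈ Zp p := by
      refine Subring.sum_mem _ fun d _ => ?_
      exact (Zp p).pow_mem (nat_mem d) _
    have hp0 : (p : ℚ) ≠ 0 := by exact_mod_cast hp.out.ne_zero
    have h2 : PowerSeries.coeff n s = (p : Zp p) * ((-(2 * ((p : Zp p) - 1))) * ⟨_, bern hp5⟩ * ⟨_, hs⟩) := by
      apply Subtype.ext
      rw [h1]
      push_cast
      rw [mul_inv]
      have h22 : (((2 : Zp p)) : ℚ) = 2 := rfl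
      rw [h22]
      field_simp
    rw [h2]
    simp

theorem MM_red {w : ℕ} (g : MvPolynomial (Fin 3) (Zp p))
    (h1 : Isobaric w (MvPolynomial.map (Zp p).subtype g))
    (h2 : NoP (MvPolynomial.map (Zp p).subtype g)) : MM w (MvPolynomial.map (red p) g) := by
  have hs : ∀ m, coeff m (MvPolynomial.map (red p) g) ≠ 0 →
      m ∈ (MvPolynomial.map (Zp p).subtype g).support := by
    intro m hm
    rw [mem_support_iff, coeff_map]
    rw [coeff_map] at hm
    intro h
    apply hm
    have : coeff m g = 0 := Subtype.ext h
    rw [this, map_zero]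
  constructor
  · intro m hm
    have := h1 m (hs m hm)
    rw [Finsupp.weight_apply, Finsupp.sum_fintype _ _ (by simp)]
    simp [Fin.sum_univ_three]
    omega
  · rw [Pd_iff]
    intro m hm
    by_contra h
    have := h2 m (hs m h)
    omega

end transfer

theorem stmt_8 (p : ℕ) (hp : p.Prime) (hp5 : 5 ≤ p)
    (A : Poly3) (hAiso : Isobaric (p - 1) A) (hAnoP : NoP A)
    (hAint : polyPInt p A) (hAPhi : Phi A = EAs p)
    (k : ℕ) (hk4 : 4 ≤ k) (hkp : k ≤ p + 1)
    (F : Poly3) (hFiso : Isobaric k F) (hFnoP : NoP F) (hFint : polyPInt p F)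
    (i : ℕ) (hi : i ≤ k - 1) :
    ∃ G H : Poly3, polyPInt p G ∧ polyPInt p H ∧
      Dop^[p ^ 2 - i * p] F = A ^ (2 * p + 1 - k - i) * G + (p : Poly3) * H := by
  have : Fact p.Prime := ⟨hp⟩
  obtain ⟨a, rfl⟩ := poly_lift hAint
  obtain ⟨f, rfl⟩ := poly_lift hFint
  have h12 : (12 : ZMod p) ≠ 0 := h12_of p hp hp5
  have hn12 : ¬ p ∣ 12 := by
    intro h
    apply h12
    have := (ZMod.natCast_eq_zero_iff 12 p).mpr h
    exact_mod_cast this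
  have hu : ((12 : ℕ) : ℚ)⁻¹ ∈ Zp p := nat_inv_mem 12 hn12
  have hu1 : 12 * (⟨_, hu⟩ : Zp p) = 1 := by
    apply Subtype.ext
    change (12 : ℚ) * ((12 : ℕ) : ℚ)⁻¹ = 1
    norm_num
  have hA1 : Psi (bc (ZMod p) e2Z) (bc (ZMod p) e4Z) (bc (ZMod p) e6Z)
      (MvPolynomial.map (red p) a) = 1 := by
    rw [Psi, ← Psi_map]
    apply EA_red hp5
    rw [Psi_map, e2Q, e4Q, e6Q]
    exact hAPhi
  obtain ⟨G, hG⟩ := modp_main (edata h12) p hp hp5 (MM_red a hAiso hAnoP) hA1 hk4 hkp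
    (MM_red f hFiso hFnoP) i hi
  obtain ⟨g, rfl⟩ := MvPolynomial.map_surjective (red p) red_surj G
  rw [← DZ_iter h12 (red p) _ hu1, ← map_pow, ← map_mul, ← sub_eq_zero, ← map_sub] at hG
  obtain ⟨H, hH⟩ := poly_ker hG
  refine ⟨_, _, poly_int g, poly_int H, ?_⟩
  have hD : (Dop : Poly3 → Poly3) = Dm ℚ := funext Dop_eq
  rw [hD, ← DZ_iter (by norm_num) (Zp p).subtype _ hu1, sub_eq_iff_eq_add.mp hH]
  rw [map_add, map_mul, map_mul, map_pow, map_natCast, add_comm]
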